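/- arXiv:1412.2276 — 6 statements merged into one kernel-verified Lean document; each statement's English description precedes it below -/
import Mathlib

section
/- Let $N \ge 1$, let $x_0, \dots, x_N$ be distinct real points and $w_0, \dots, w_N$ real weights such that the quadrature rule is exact for degree $2N-1$, and let $(p_k)_{k=0}^N$ be an orthogonal polynomial family with $\gamma_k = \sum_{j=0}^N w_j p_k(x_j)^2 \ne 0$ for all $k \le N$. Then for each $j \le N$ the Lagrange cardinal polynomial satisfies, as an identity of polynomials, $\ell_j = w_j \sum_{k=0}^N \frac{p_k(x_j)}{\gamma_k}\, p_k$. -/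
open Polynomial

/-- The discrete values of a family that is orthogonal for the bilinear form `∑ j, w j * f j * g j`
with nonzero squared norms satisfy the dual orthogonality relation. -/
theorem dual_orthogonality {ι K : Type*} [Fintype ι] [DecidableEq ι] [Field K]
    (P : ι → ι → K) (w γ : ι → K) (hγ : ∀ k, γ k ≠ 0)
    (h : ∀ k l, ∑ j, w j * (P k j * P l j) = if k = l then γ k else 0) (i j : ι) :
    w j * ∑ k, P k j / γ k * P k i = if j = i then 1 else 0 := by
  have hMB : Matrix.of P * Matrix.of (fun j k => w j * (P k j / γ k)) = 1 := by
    ext k l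
    have hkl : ∑ j, P k j * (w j * (P l j / γ l)) = (∑ j, w j * (P k j * P l j)) / γ l := by
      rw [Finset.sum_div]
      exact Finset.sum_congr rfl fun j _ => by ring
    rw [Matrix.mul_apply, Matrix.one_apply]
    simp only [Matrix.of_apply]
    rw [hkl, h]
    split_ifs with hk
    · rw [hk, div_self (hγ l)]
    · exact zero_div _
  have hBM := congrArg (fun A : Matrix ι ι K => A j i) (mul_eq_one_comm.mp hMB)
  simp only [Matrix.mul_apply, Matrix.one_apply] at hBM
  simpa [Finset.mul_sum, mul_assoc] using hBM

theorem cardinal_function_expansion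
    (N : ℕ) (hN : 1 ≤ N)
    (x w : Fin (N + 1) → ℝ) (hx : Function.Injective x)
    (hquad : ∀ f : Polynomial ℝ, f.degree ≤ (2 * N - 1 : ℕ) →
      ∑ j, w j * f.eval (x j) = ∫ t in (-1 : ℝ)..1, f.eval t)
    (p : Fin (N + 1) → Polynomial ℝ)
    (hdeg : ∀ k : Fin (N + 1), (p k).degree = ((k : ℕ) : WithBot ℕ))
    (horth : ∀ j k : Fin (N + 1), j ≠ k →
      (∫ t in (-1 : ℝ)..1, (p j).eval t * (p k).eval t) = 0)
    (γ : Fin (N + 1) → ℝ)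
    (hγ : ∀ k, γ k = ∑ j, w j * ((p k).eval (x j)) ^ 2)
    (hγ0 : ∀ k, γ k ≠ 0) :
    ∀ j : Fin (N + 1),
      Lagrange.basis Finset.univ x j =
        Polynomial.C (w j) * ∑ k, Polynomial.C ((p k).eval (x j) / γ k) * p k := by
  have hortho : ∀ k l, ∑ j, w j * ((p k).eval (x j) * (p l).eval (x j)) =
      if k = l then γ k else 0 := by
    intro k l
    split_ifs with hkl
    · subst hkl
      simp only [hγ, pow_two]
    · have hd : (p k * p l).degree ≤ (2 * N - 1 : ℕ) := by
        rw [degree_mul, hdeg, hdeg, ← Nat.cast_add]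
        have hne : (k : ℕ) ≠ l := fun h => hkl (Fin.ext h)
        exact Nat.cast_le.mpr (by omega)
      simpa only [eval_mul, horth k l hkl] using hquad (p k * p l) hd
  intro j
  have hsum : (∑ k, C ((p k).eval (x j) / γ k) * p k).degree < (N + 1 : ℕ) := by
    refine (degree_sum_le _ _).trans_lt ((Finset.sup_lt_iff (WithBot.bot_lt_coe _)).mpr ?_)
    intro k _
    refine (C_mul' (R := ℝ) _ _ ▸ degree_smul_le _ _).trans_lt ?_
    rw [hdeg]
    exact Nat.cast_lt.mpr k.isLt
  refine eq_of_degrees_lt_of_eval_index_eq Finset.univ hx.injOn ?_ ?_ ?_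
  · rw [Lagrange.degree_basis hx.injOn (Finset.mem_univ j), Finset.card_univ, Fintype.card_fin]
    exact Nat.cast_lt.mpr (by omega)
  · rw [Finset.card_univ, Fintype.card_fin]
    exact (C_mul' (R := ℝ) _ _ ▸ degree_smul_le _ _).trans_lt hsum
  · intro i _
    rw [eval_mul, eval_C, eval_finsetSum]
    simp only [eval_mul, eval_C]
    rw [dual_orthogonality (fun k j => (p k).eval (x j)) w γ hγ0 hortho i j]
    split_ifs with hij
    · rw [← hij, Lagrange.eval_basis_self hx.injOn (Finset.mem_univ j)]
    · exact Lagrange.eval_basis_of_ne hij (Finset.mem_univ i)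
end

section
/- Let $N \ge 1$, let $x_0, \dots, x_N$ be distinct real points and $w_0, \dots, w_N$ real weights such that the quadrature rule is exact for degree $2N-1$, and let $(p_k)_{k=0}^N$ be an orthogonal polynomial family with normalizations $h_k = \int_{-1}^1 p_k(x)^2\,dx$ and $\gamma_k = \sum_{j=0}^N w_j p_k(x_j)^2 \ne 0$ for all $k \le N$. Then the exact mass matrix is the diagonal quadrature approximation plus a rank-one update: for all $i, j \le N$, $M_{ij} = \int_{-1}^1 \ell_i(x)\,\ell_j(x)\,dx = w_i\,\delta_{ij} + \alpha\, w_i w_j\, p_N(x_i)\, p_N(x_j)$, where $\alpha = (h_N - \gamma_N)/\gamma_N^2$. -/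
open Polynomial

/-- Integration over `[-1, 1]`, as a linear functional on polynomials. -/
noncomputable def Polynomial.integralFunctional : ℝ[X] →ₗ[ℝ] ℝ where
  toFun f := ∫ t in (-1 : ℝ)..1, f.eval t
  map_add' f g := by
    simp only [eval_add]
    exact intervalIntegral.integral_add (f.continuous.intervalIntegrable _ _)
      (g.continuous.intervalIntegrable _ _)
  map_smul' c f := by simp

/-- The quadrature rule with nodes `x` and weights `w`, as a linear functional on polynomials. -/
noncomputable def Polynomial.quadratureFunctional {ι : Type*} [Fintype ι] (x w : ι → ℝ) :
    ℝ[X] →ₗ[ℝ] ℝ where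
  toFun f := ∑ j, w j * f.eval (x j)
  map_add' f g := by simp [mul_add, Finset.sum_add_distrib]
  map_smul' c f := by simp [Finset.mul_sum, mul_left_comm]

theorem Polynomial.exists_degree_sub_C_mul_lt {K : Type*} [Field K] {n : ℕ} {f q : K[X]}
    (hq : q.degree = n) (hf : f.degree < (n + 1 : ℕ)) : ∃ c : K, (f - C c * q).degree < n := by
  have hq0 : q.coeff n ≠ 0 := coeff_ne_zero_of_eq_degree hq
  refine ⟨f.coeff n / q.coeff n, (degree_lt_iff_coeff_zero _ _).2 fun m hm => ?_⟩
  rcases hm.eq_or_lt with rfl | hm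
  · simp [hq0]
  · have h1 : f.coeff m = 0 := (degree_lt_iff_coeff_zero _ _).1 hf m hm
    have h2 : q.coeff m = 0 :=
      coeff_eq_zero_of_degree_lt (by rw [hq]; exact_mod_cast hm)
    simp [h1, h2]

/-- A linear functional that kills `p k * q` for all `k < n`, where `p k` has degree `k`, kills
`f * q` for every `f` of degree less than `n`. -/
theorem Polynomial.linearMap_mul_eq_zero_of_degree_lt {K : Type*} [Field K] (L : K[X] →ₗ[K] K)
    (p : ℕ → K[X]) (q : K[X]) (n : ℕ) (hdeg : ∀ k < n, (p k).degree = k)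
    (hL : ∀ k < n, L (p k * q) = 0) (f : K[X]) (hf : f.degree < n) : L (f * q) = 0 := by
  induction n generalizing f with
  | zero =>
    have : f = 0 := by simpa using hf
    simp [this]
  | succ n ih =>
    obtain ⟨c, hc⟩ := exists_degree_sub_C_mul_lt (hdeg n n.lt_succ_self) hf
    have := ih (fun k hk => hdeg k (hk.trans n.lt_succ_self))
      (fun k hk => hL k (hk.trans n.lt_succ_self)) _ hc
    rwa [sub_mul, mul_assoc, ← smul_eq_C_mul, map_sub, map_smul, hL n n.lt_succ_self, smul_zero,
      sub_zero] at this

theorem mass_matrix_rank_one_update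
    (N : ℕ) (hN : 1 ≤ N)
    (x w : Fin (N + 1) → ℝ) (hx : Function.Injective x)
    (hquad : ∀ f : Polynomial ℝ, f.degree ≤ (2 * N - 1 : ℕ) →
      ∑ j, w j * f.eval (x j) = ∫ t in (-1 : ℝ)..1, f.eval t)
    (p : Fin (N + 1) → Polynomial ℝ)
    (hdeg : ∀ k : Fin (N + 1), (p k).degree = ((k : ℕ) : WithBot ℕ))
    (horth : ∀ j k : Fin (N + 1), j ≠ k →
      (∫ t in (-1 : ℝ)..1, (p j).eval t * (p k).eval t) = 0)
    (h γ : Fin (N + 1) → ℝ)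
    (hh : ∀ k, h k = ∫ t in (-1 : ℝ)..1, ((p k).eval t) ^ 2)
    (hγ : ∀ k, γ k = ∑ j, w j * ((p k).eval (x j)) ^ 2)
    (hγ0 : ∀ k, γ k ≠ 0)
    (α : ℝ)
    (hα : α = (h (Fin.last N) - γ (Fin.last N)) / (γ (Fin.last N)) ^ 2) :
    ∀ i j : Fin (N + 1),
      (∫ t in (-1 : ℝ)..1,
          (Lagrange.basis Finset.univ x i).eval t * (Lagrange.basis Finset.univ x j).eval t) =
        (if i = j then w i else 0) +
          α * w i * w j * (p (Fin.last N)).eval (x i) * (p (Fin.last N)).eval (x j) := by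
  intro i j
  set L := integralFunctional
  set Q := quadratureFunctional x w
  have L_apply : ∀ f, L f = ∫ t in (-1 : ℝ)..1, f.eval t := fun _ => rfl
  have Q_apply : ∀ f, Q f = ∑ j, w j * f.eval (x j) := fun _ => rfl
  set P := p (Fin.last N) with hP
  have hPdeg : P.degree = N := by simpa using hdeg (Fin.last N)
  have exact_mul : ∀ f g : ℝ[X], f.degree < N → g.degree ≤ N → L (f * g) = Q (f * g) := by
    intro f g hf hg
    refine (hquad _ ?_).symm
    have hf' : f.degree ≤ (N - 1 : ℕ) := by
      rw [← Nat.sub_add_cancel hN] at hf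
      exact degree_le_iff_coeff_zero _ _ |>.2 fun m hm =>
        (degree_lt_iff_coeff_zero _ _).1 hf m (by exact_mod_cast hm)
    refine (degree_mul_le_of_le hf' hg).trans ?_
    exact_mod_cast (by omega : N - 1 + N ≤ 2 * N - 1)
  have hperp : ∀ f : ℝ[X], f.degree < N → L (f * P) = 0 := by
    refine linearMap_mul_eq_zero_of_degree_lt L (fun k => p (Fin.ofNat (N + 1) k)) P N ?_ ?_
    · intro k hk
      rw [hdeg, Fin.val_ofNat, Nat.mod_eq_of_lt (by omega)]
    · intro k hk
      rw [L_apply]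
      simp only [eval_mul]
      refine horth _ _ fun h => ?_
      have := congrArg Fin.val h
      rw [Fin.val_ofNat, Nat.mod_eq_of_lt (by omega), Fin.val_last] at this
      omega
  have hLPP : L (P * P) = h (Fin.last N) := by simp [hh, L_apply, hP, sq]
  have hQPP : Q (P * P) = γ (Fin.last N) := by simp [hγ, Q_apply, hP, sq]
  have basis_eval : ∀ a b,
      (Lagrange.basis Finset.univ x a).eval (x b) = if a = b then 1 else 0 := by
    intro a b
    split_ifs with hab
    · subst hab
      exact Lagrange.eval_basis_self hx.injOn (Finset.mem_univ _)
    · exact Lagrange.eval_basis_of_ne hab (Finset.mem_univ _)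
  have basis_decomp : ∀ a, ∃ r : ℝ[X], r.degree < N ∧ Lagrange.basis Finset.univ x a =
      (w a * P.eval (x a) / γ (Fin.last N)) • P + r := by
    intro a
    have hd : (Lagrange.basis Finset.univ x a).degree < (N + 1 : ℕ) := by
      rw [Lagrange.degree_basis hx.injOn (Finset.mem_univ _)]
      simp only [Finset.card_univ, Fintype.card_fin, Nat.add_sub_cancel]
      exact_mod_cast N.lt_succ_self
    obtain ⟨c, hc⟩ := exists_degree_sub_C_mul_lt hPdeg hd
    have h0 := (exact_mul _ P hc hPdeg.le).symm.trans (hperp _ hc)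
    have hQ : Q (Lagrange.basis Finset.univ x a * P) = w a * P.eval (x a) := by
      simp [Q_apply, basis_eval]
    rw [sub_mul, mul_assoc, ← smul_eq_C_mul, map_sub, map_smul, hQ, hQPP, smul_eq_mul] at h0
    have hc' : w a * P.eval (x a) / γ (Fin.last N) = c := by
      rw [div_eq_iff (hγ0 _)]
      linarith
    exact ⟨_, hc, by rw [hc', smul_eq_C_mul]; ring⟩
  have hQij : Q (Lagrange.basis Finset.univ x i * Lagrange.basis Finset.univ x j) =
      if i = j then w i else 0 := by
    rcases eq_or_ne i j with rfl | hij
    · simp [Q_apply, basis_eval]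
    · simp [Q_apply, basis_eval, hij]
  have hLij : L (Lagrange.basis Finset.univ x i * Lagrange.basis Finset.univ x j) =
      ∫ t in (-1 : ℝ)..1,
        (Lagrange.basis Finset.univ x i).eval t * (Lagrange.basis Finset.univ x j).eval t := by
    simp [L_apply]
  rw [← hLij, ← hQij]
  obtain ⟨r, hr, hri⟩ := basis_decomp i
  obtain ⟨s, hs, hsj⟩ := basis_decomp j
  rw [hri, hsj]
  have h1 := exact_mul r P hr hPdeg.le
  have h2 := exact_mul s P hs hPdeg.le
  have h3 := exact_mul r s hr (hs.le)
  have expand : ∀ a b : ℝ, (a • P + r) * (b • P + s) =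
      (a * b) • (P * P) + a • (s * P) + b • (r * P) + r * s := by
    intro a b
    simp only [smul_eq_C_mul, C_mul]
    ring
  have hγN := hγ0 (Fin.last N)
  simp only [expand, map_add, map_smul, smul_eq_mul, h1, h2, h3, hLPP, hQPP, hα]
  field_simp
  ring
end

section
/- Let $N \ge 1$, let $x_0, \dots, x_N$ be distinct real points and $w_0, \dots, w_N$ strictly positive real weights such that the quadrature rule is exact for degree $2N-1$, and let $(p_k)_{k=0}^N$ be an orthogonal polynomial family with $h_N = \int_{-1}^1 p_N(x)^2\,dx > 0$ and $\gamma_N = \sum_{j=0}^N w_j p_N(x_j)^2$. Define the matrix $K_{ij} = \frac{1}{w_i}\delta_{ij} + \beta\, p_N(x_i)\, p_N(x_j)$ with $\beta = -\,(h_N - \gamma_N)/(\gamma_N h_N)$. Then $K$ is the inverse of the exact mass matrix $M_{ij} = \int_{-1}^1 \ell_i(x)\,\ell_j(x)\,dx$: for all $i, k \le N$, $\sum_{j=0}^N M_{ij} K_{jk} = \delta_{ik}$ and $\sum_{j=0}^N K_{ij} M_{jk} = \delta_{ik}$. -/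
open Polynomial

/-- The integral over `[-1, 1]` as a linear functional on real polynomials. -/
noncomputable def legendreFunctional : ℝ[X] →ₗ[ℝ] ℝ where
  toFun f := ∫ t in (-1 : ℝ)..1, f.eval t
  map_add' f g := by
    simp only [eval_add]
    exact intervalIntegral.integral_add (f.continuous.intervalIntegrable _ _)
      (g.continuous.intervalIntegrable _ _)
  map_smul' c f := by
    simp only [eval_smul, smul_eq_mul, RingHom.id_apply]
    exact intervalIntegral.integral_const_mul _ _

theorem legendreFunctional_apply (f : ℝ[X]) :
    legendreFunctional f = ∫ t in (-1 : ℝ)..1, f.eval t := rfl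

theorem exists_degree_sub_smul_lt {F : Type*} [Field F] {n : ℕ} {f q : F[X]}
    (hf : f.degree ≤ n) (hq : q.degree = n) : ∃ c : F, (f - c • q).degree < n := by
  have hq0 : q.coeff n ≠ 0 := coeff_ne_zero_of_eq_degree hq
  refine ⟨f.coeff n / q.coeff n, ?_⟩
  rw [degree_lt_iff_coeff_zero]
  intro m hm
  rcases hm.eq_or_lt with rfl | hm
  · simp [hq0]
  · have h1 : f.coeff m = 0 :=
      coeff_eq_zero_of_degree_lt (hf.trans_lt (by exact_mod_cast hm))
    have h2 : q.coeff m = 0 :=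
      coeff_eq_zero_of_degree_lt (hq.le.trans_lt (by exact_mod_cast hm))
    simp [h1, h2]

/-- A functional vanishing on polynomials of degrees `0, …, n - 1` vanishes below degree `n`. -/
theorem linearMap_eq_zero_of_degree_lt {F : Type*} [Field F] (L : F[X] →ₗ[F] F) (n : ℕ)
    (h : ∀ k < n, ∃ q : F[X], q.degree = k ∧ L q = 0) {f : F[X]} (hf : f.degree < n) :
    L f = 0 := by
  induction n generalizing f with
  | zero =>
    have : f = 0 := by
      rw [← degree_eq_bot]
      exact Nat.WithBot.lt_zero_iff.mp (by simpa using hf)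
    simp [this]
  | succ n ih =>
    obtain ⟨q, hq, hLq⟩ := h n n.lt_succ_self
    obtain ⟨c, hc⟩ := exists_degree_sub_smul_lt (Order.lt_succ_iff.mp hf) hq
    have := ih (fun k hk => h k (hk.trans n.lt_succ_self)) hc
    simpa [hLq] using this

/-- A functional vanishing below degree `2 * n` has rank one on products of two polynomials of
degree at most `n`: it only sees their leading parts `a • q` and `b • q`. -/
theorem linearMap_mul_eq_of_degree_le {F : Type*} [Field F] (D : F[X] →ₗ[F] F) {n : ℕ}
    (hD : ∀ f : F[X], f.degree < (2 * n : ℕ) → D f = 0) {f g q : F[X]} {a b : F}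
    (hq : q.degree = n) (hg : g.degree ≤ n)
    (ha : (f - a • q).degree < n) (hb : (g - b • q).degree < n) :
    D (f * g) = a * b * D (q * q) := by
  have hsum : ((n : WithBot ℕ) + n) = (2 * n : ℕ) := by rw [two_mul]; norm_cast
  have key {u v : F[X]} (hu : u.degree < n) (hv : v.degree ≤ n) : D (u * v) = 0 := by
    apply hD
    rw [← hsum, degree_mul]
    by_cases hv0 : v = 0
    · rw [hv0, degree_zero, WithBot.add_bot]
      exact WithBot.bot_lt_coe _
    · exact WithBot.add_lt_add_of_lt_of_le (by simpa using hv0) hu hv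
  have hsplit : f * g = (f - a • q) * g + a • ((g - b • q) * q) + (a * b) • (q * q) := by
    simp only [smul_eq_C_mul, C_mul]
    ring
  rw [hsplit, map_add, map_add, map_smul, map_smul, key ha hg, key hb hq.le]
  simp

/-- Sherman–Morrison inversion for a diagonal matrix plus a rank-one matrix. -/
theorem diagonal_add_vecMulVec_mul_eq_one {ι F : Type*} [Fintype ι] [DecidableEq ι] [Field F]
    {w a v : ι → F} {h γ : F} (hw : ∀ i, w i ≠ 0) (hh : h ≠ 0) (hγ : γ ≠ 0)
    (ha : ∀ i, w i * v i = γ * a i) (hγv : γ = ∑ i, w i * v i ^ 2) :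
    (Matrix.of fun i j => (if i = j then w i else 0) + (h - γ) * a i * a j) *
      (Matrix.of fun i j => (if i = j then 1 / w i else 0) + -(h - γ) / (γ * h) * v i * v j) =
      1 := by
  have hav : ∑ i, a i * v i = 1 := by
    have : γ * ∑ i, a i * v i = γ * 1 := by
      rw [Finset.mul_sum, mul_one]
      conv_rhs => rw [hγv]
      refine Finset.sum_congr rfl fun i _ => ?_
      rw [← mul_assoc, ← ha]
      ring
    exact mul_left_cancel₀ hγ this
  ext i k
  set β := -(h - γ) / (γ * h) with hβ
  have hak : a k / w k = v k / γ := by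
    rw [div_eq_div_iff (hw k) hγ]
    linear_combination -(ha k)
  have hai : a i = w i * v i / γ := by
    rw [eq_div_iff hγ, ha i]
    ring
  have hterm : ∀ j, ((if i = j then w i else 0) + (h - γ) * a i * a j) *
      ((if j = k then 1 / w j else 0) + β * v j * v k) =
      (if i = j then w i * ((if j = k then 1 / w j else 0) + β * v j * v k) else 0) +
      (if j = k then (h - γ) * a i * (a j / w j) else 0) +
      (h - γ) * a i * β * v k * (a j * v j) := by
    intro j
    split_ifs <;> ring
  rw [Matrix.mul_apply]
  simp only [Matrix.of_apply]
  rw [Finset.sum_congr rfl fun j _ => hterm j, Finset.sum_add_distrib, Finset.sum_add_distrib,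
    ← Finset.mul_sum, hav, Finset.sum_ite_eq, Finset.sum_ite_eq', Matrix.one_apply, hak, hai]
  have hwi := hw i
  simp only [Finset.mem_univ, if_true]
  split_ifs <;> rw [hβ] <;> field_simp <;> ring

theorem inverse_mass_matrix
    (N : ℕ) (hN : 1 ≤ N)
    (x : Fin (N + 1) → ℝ) (hx : Function.Injective x)
    (w : Fin (N + 1) → ℝ) (hw : ∀ j, 0 < w j)
    (hquad : ∀ f : Polynomial ℝ, f.degree ≤ (2 * N - 1 : ℕ) →
      ∑ j, w j * f.eval (x j) = ∫ t in (-1 : ℝ)..1, f.eval t)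
    (p : Fin (N + 1) → Polynomial ℝ)
    (hdeg : ∀ k : Fin (N + 1), (p k).degree = ((k : ℕ) : WithBot ℕ))
    (horth : ∀ j k : Fin (N + 1), j ≠ k →
      (∫ t in (-1 : ℝ)..1, (p j).eval t * (p k).eval t) = 0)
    (hN' γN : ℝ)
    (hhN : hN' = ∫ t in (-1 : ℝ)..1, ((p (Fin.last N)).eval t) ^ 2)
    (hhN0 : 0 < hN')
    (hγN : γN = ∑ j, w j * ((p (Fin.last N)).eval (x j)) ^ 2)
    (β : ℝ) (hβ : β = -(hN' - γN) / (γN * hN'))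
    (M K : Matrix (Fin (N + 1)) (Fin (N + 1)) ℝ)
    (hM : ∀ i j, M i j =
      ∫ t in (-1 : ℝ)..1,
        (Lagrange.basis Finset.univ x i).eval t * (Lagrange.basis Finset.univ x j).eval t)
    (hK : ∀ i j, K i j =
      (if i = j then 1 / w i else 0) +
        β * (p (Fin.last N)).eval (x i) * (p (Fin.last N)).eval (x j)) :
    ∀ i k : Fin (N + 1),
      (∑ j, M i j * K j k) = (if i = k then 1 else 0) ∧
      (∑ j, K i j * M j k) = (if i = k then 1 else 0) := by
  classical
  set P := p (Fin.last N) with hP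
  have hPdeg : P.degree = (N : ℕ) := by rw [hP, hdeg, Fin.val_last]
  have hP0 : P ≠ 0 := by
    rintro h
    simp [h] at hPdeg
  let Q : ℝ[X] →ₗ[ℝ] ℝ := ∑ j, w j • leval (x j)
  have hQ : ∀ f, Q f = ∑ j, w j * f.eval (x j) := fun f => by
    simp [Q, LinearMap.sum_apply]
  let D := legendreFunctional - Q
  have hD : ∀ f : ℝ[X], f.degree < (2 * N : ℕ) → D f = 0 := by
    intro f hf
    have hle : f.degree ≤ (2 * N - 1 : ℕ) := by
      apply Order.le_of_lt_succ
      convert hf using 1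
      change ((2 * N - 1 + 1 : ℕ) : WithBot ℕ) = _
      congr 1
      omega
    rw [LinearMap.sub_apply, hQ, hquad f hle, legendreFunctional_apply, sub_self]
  have hIP : legendreFunctional (P * P) = hN' := by
    rw [legendreFunctional_apply, hhN]
    simp only [eval_mul, sq]
  have hQP : Q (P * P) = γN := by
    rw [hQ, hγN]
    simp only [eval_mul, sq]
  have hDP : D (P * P) = hN' - γN := by rw [LinearMap.sub_apply, hIP, hQP]
  have hγ : γN ≠ 0 := by
    intro h0
    rw [hγN, Finset.sum_eq_zero_iff_of_nonneg fun j _ => mul_nonneg (hw j).le (sq_nonneg _)] at h0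
    refine hP0 (eq_zero_of_degree_lt_of_eval_index_eq_zero Finset.univ hx.injOn ?_ ?_)
    · rw [hPdeg, Finset.card_univ, Fintype.card_fin]
      exact_mod_cast N.lt_succ_self
    · intro j hj
      simpa [(hw j).ne'] using h0 j hj
  let l := Lagrange.basis Finset.univ x
  have hldeg : ∀ i, (l i).degree ≤ N := fun i => by
    rw [Lagrange.degree_basis hx.injOn (Finset.mem_univ i)]
    simp
  have hleval : ∀ i j, (l i).eval (x j) = if i = j then 1 else 0 := fun i j => by
    split_ifs with h
    · rw [← h]
      exact Lagrange.eval_basis_self hx.injOn (Finset.mem_univ i)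
    · exact Lagrange.eval_basis_of_ne h (Finset.mem_univ j)
  choose a ha using fun i => exists_degree_sub_smul_lt (hldeg i) hPdeg
  have hlow : ∀ f : ℝ[X], f.degree < N → legendreFunctional (f * P) = 0 := by
    intro f hf
    refine linearMap_eq_zero_of_degree_lt
      (legendreFunctional ∘ₗ LinearMap.mulRight ℝ P) N (fun k hk => ?_) hf
    refine ⟨p ⟨k, by omega⟩, hdeg _, ?_⟩
    have := horth ⟨k, by omega⟩ (Fin.last N) (by simp [Fin.ext_iff]; omega)
    simpa [legendreFunctional_apply] using this
  have hIl : ∀ i, legendreFunctional (l i * P) = a i * hN' := by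
    intro i
    have := hlow _ (ha i)
    rw [sub_mul, map_sub, smul_mul_assoc, map_smul, hIP, smul_eq_mul] at this
    linarith
  have hwa : ∀ i, w i * P.eval (x i) = γN * a i := by
    intro i
    have h1 := linearMap_mul_eq_of_degree_le D hD (b := 1) hPdeg hPdeg.le (ha i)
      (by simp)
    rw [hDP, LinearMap.sub_apply, hIl, hQ] at h1
    simp only [eval_mul, hleval, ite_mul, mul_ite, one_mul, zero_mul, mul_zero,
      Finset.sum_ite_eq, Finset.mem_univ, if_true] at h1
    linarith
  have hMeq : M = Matrix.of fun i j =>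
      (if i = j then w i else 0) + (hN' - γN) * a i * a j := by
    ext i j
    have h1 := linearMap_mul_eq_of_degree_le D hD hPdeg (hldeg j) (ha i) (ha j)
    rw [hDP, LinearMap.sub_apply, hQ, legendreFunctional_apply] at h1
    simp only [eval_mul, hleval, mul_ite, mul_zero, mul_one, Finset.sum_ite_eq,
      Finset.mem_univ, if_true] at h1
    rw [hM, Matrix.of_apply]
    have hswap : (if i = j then w j else 0) = if i = j then w i else 0 := by
      split_ifs with h
      · rw [h]
      · rfl
    linear_combination h1 + hswap
  have hKeq : K = Matrix.of fun i j => (if i = j then 1 / w i else 0) +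
      -(hN' - γN) / (γN * hN') * P.eval (x i) * P.eval (x j) := by
    ext i j
    rw [hK, hβ, Matrix.of_apply]
  have hMK : M * K = 1 := by
    rw [hMeq, hKeq]
    exact diagonal_add_vecMulVec_mul_eq_one (fun i => (hw i).ne') hhN0.ne' hγ hwa hγN
  have hKM : K * M = 1 := mul_eq_one_comm.mp hMK
  intro i k
  rw [← Matrix.mul_apply, ← Matrix.mul_apply, hMK, hKM, Matrix.one_apply]
  exact ⟨rfl, rfl⟩
end

section
/- Let $N \ge 1$, let $x_0, \dots, x_N$ be distinct real points and $w_0, \dots, w_N$ real weights such that the quadrature rule is exact for degree $2N-1$. Then the difference between the exact mass matrix $M_{ij} = \int_{-1}^1 \ell_i(x)\,\ell_j(x)\,dx$ and the diagonal Gauss-Lobatto approximation $\operatorname{diag}(w_0, \dots, w_N)$ is a matrix of rank at most $1$. -/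
open Polynomial

/-- A product of two polynomials of degree at most `n`, with its term of degree `2 * n` removed. -/
theorem Polynomial.degree_mul_sub_C_mul_X_pow_lt {R : Type*} [CommRing R] {n : ℕ} {p q : R[X]}
    (hp : p.natDegree ≤ n) (hq : q.natDegree ≤ n) :
    (p * q - C (p.coeff n * q.coeff n) * X ^ (2 * n)).degree < ((2 * n : ℕ) : WithBot ℕ) := by
  rw [degree_lt_iff_coeff_zero]
  intro m hm
  rw [coeff_sub, coeff_C_mul, coeff_X_pow]
  rcases hm.eq_or_lt with rfl | hlt
  · rw [two_mul, coeff_mul_add_eq_of_natDegree_le hp hq]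
    simp
  · rw [coeff_eq_zero_of_natDegree_lt (natDegree_mul_le.trans_lt (by omega)), if_neg hlt.ne']
    simp

theorem mass_matrix_minus_diagonal_rank_le_one
    (N : ℕ) (hN : 1 ≤ N)
    (x w : Fin (N + 1) → ℝ) (hx : Function.Injective x)
    (hquad : ∀ f : Polynomial ℝ, f.degree ≤ (2 * N - 1 : ℕ) →
      ∑ j, w j * f.eval (x j) = ∫ t in (-1 : ℝ)..1, f.eval t)
    (M : Matrix (Fin (N + 1)) (Fin (N + 1)) ℝ)
    (hM : ∀ i j, M i j =
      ∫ t in (-1 : ℝ)..1,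
        (Lagrange.basis Finset.univ x i).eval t * (Lagrange.basis Finset.univ x j).eval t) :
    (M - Matrix.diagonal w).rank ≤ 1 := by
  let l := Lagrange.basis Finset.univ x
  let c : Fin (N + 1) → ℝ := fun i ↦ (l i).coeff N
  let e : ℝ := (∫ t in (-1 : ℝ)..1, t ^ (2 * N)) - ∑ k, w k * x k ^ (2 * N)
  have hl : ∀ i, (l i).natDegree ≤ N := fun i ↦ by
    simp [l, Lagrange.natDegree_basis hx.injOn (Finset.mem_univ i)]
  have hnode : ∀ i k, (l i).eval (x k) = if i = k then 1 else 0 := fun i k ↦ by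
    split_ifs with h
    · subst h
      exact Lagrange.eval_basis_self hx.injOn (Finset.mem_univ i)
    · exact Lagrange.eval_basis_of_ne h (Finset.mem_univ k)
  have hrank : M - Matrix.diagonal w = Matrix.vecMulVec c (e • c) := by
    ext i j
    have hq := hquad (l i * l j - C (c i * c j) * X ^ (2 * N)) <| by
      have h := degree_mul_sub_C_mul_X_pow_lt (hl i) (hl j)
      rw [degree_lt_iff_coeff_zero] at h
      rw [degree_le_iff_coeff_zero]
      intro m hm
      have hm' : 2 * N - 1 < m := by exact_mod_cast hm
      exact h m (by omega)
    have hsum : ∑ k, w k * ((l i).eval (x k) * (l j).eval (x k)) = Matrix.diagonal w i j := by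
      rcases eq_or_ne i j with rfl | hij
      · simp [hnode]
      · simp [hnode, hij]
    simp only [eval_sub, eval_mul, eval_C, eval_pow, eval_X, mul_sub, Finset.sum_sub_distrib,
      hsum] at hq
    rw [intervalIntegral.integral_sub
      ((by fun_prop : Continuous fun t ↦ (l i).eval t * (l j).eval t).intervalIntegrable _ _)
      ((by fun_prop : Continuous fun t : ℝ ↦ c i * c j * t ^ (2 * N)).intervalIntegrable _ _),
      intervalIntegral.integral_const_mul, ← hM i j] at hq
    simp only [mul_left_comm (w _), ← Finset.mul_sum] at hq
    simp only [Matrix.sub_apply, Matrix.vecMulVec_apply, Pi.smul_apply, smul_eq_mul, e]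
    linear_combination -hq
  rw [hrank]
  exact Matrix.rank_vecMulVec_le _ _
end

section
/- Let $N \ge 1$, let $x_0, \dots, x_N$ be distinct real points and $w_0, \dots, w_N$ nonzero real weights such that the quadrature rule is exact for degree $2N-1$. Then applying the inverse of the approximate (diagonal) mass matrix to the stiffness matrix yields the exact differentiation matrix: for all $i, k \le N$, $\sum_{j=0}^N \frac{1}{w_i}\,\delta_{ij}\, S_{jk} = \ell_k'(x_i)$, where $S_{jk} = \int_{-1}^1 \ell_j(x)\,\ell_k'(x)\,dx$. -/
open Polynomial

theorem approx_inverse_mass_gives_exact_diff_matrix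
    (N : ℕ) (hN : 1 ≤ N)
    (x : Fin (N + 1) → ℝ) (hx : Function.Injective x)
    (w : Fin (N + 1) → ℝ) (hw : ∀ j, w j ≠ 0)
    (hquad : ∀ f : Polynomial ℝ, f.degree ≤ (2 * N - 1 : ℕ) →
      ∑ j, w j * f.eval (x j) = ∫ t in (-1 : ℝ)..1, f.eval t)
    (S : Matrix (Fin (N + 1)) (Fin (N + 1)) ℝ)
    (hS : ∀ j k, S j k =
      ∫ t in (-1 : ℝ)..1,
        (Lagrange.basis Finset.univ x j).eval t *
          (Polynomial.derivative (Lagrange.basis Finset.univ x k)).eval t) :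
    ∀ i k : Fin (N + 1),
      (∑ j, (if i = j then 1 / w i else 0) * S j k) =
        (Polynomial.derivative (Lagrange.basis Finset.univ x k)).eval (x i) := by
  intro i k
  have hinj : Set.InjOn x (Finset.univ : Finset (Fin (N + 1))) := hx.injOn
  have hnat (j : Fin (N + 1)) : (Lagrange.basis Finset.univ x j).natDegree = N := by
    simp [Lagrange.natDegree_basis hinj (Finset.mem_univ j)]
  have hdeg : (Lagrange.basis Finset.univ x i *
      derivative (Lagrange.basis Finset.univ x k)).degree ≤ (2 * N - 1 : ℕ) := by
    apply degree_le_of_natDegree_le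
    refine natDegree_mul_le.trans ?_
    have hder := natDegree_derivative_le (Lagrange.basis Finset.univ x k)
    rw [hnat] at hder ⊢
    omega
  have hS_eq : S i k = w i * (derivative (Lagrange.basis Finset.univ x k)).eval (x i) := by
    have hexact := hquad _ hdeg
    simp only [eval_mul] at hexact
    rw [hS, ← hexact, Finset.sum_eq_single i]
    · rw [Lagrange.eval_basis_self hinj (Finset.mem_univ i), one_mul]
    · intro j _ hji
      rw [Lagrange.eval_basis_of_ne hji.symm (Finset.mem_univ j), zero_mul, mul_zero]
    · simp
  simp only [ite_mul, zero_mul, Finset.sum_ite_eq, Finset.mem_univ, if_true]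
  rw [hS_eq, ← mul_assoc, one_div_mul_cancel (hw i), one_mul]
end

section
/- Let $N \ge 1$, let $x_0, \dots, x_N$ be distinct real points and $w_0, \dots, w_N$ strictly positive real weights such that the quadrature rule is exact for degree $2N-1$, and let $(p_k)_{k=0}^N$ be an orthogonal polynomial family with $h_N = \int_{-1}^1 p_N(x)^2\,dx > 0$ and $\gamma_N = \sum_{j=0}^N w_j p_N(x_j)^2$. Then applying the exact inverse mass matrix $K_{ij} = \frac{1}{w_i}\delta_{ij} + \beta\, p_N(x_i)\, p_N(x_j)$, with $\beta = -\,(h_N - \gamma_N)/(\gamma_N h_N)$, to the stiffness matrix $S_{jk} = \int_{-1}^1 \ell_j(x)\,\ell_k'(x)\,dx$ yields exactly the differentiation matrix: for all $i, k \le N$, $\sum_{j=0}^N K_{ij}\, S_{jk} = \ell_k'(x_i)$. -/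
open Polynomial

/-- If `r` is orthogonal to polynomials `p 0, …, p (n - 1)` of exact degrees `0, …, n - 1`, then it
is orthogonal to every polynomial of degree less than `n`. -/
theorem Polynomial.intervalIntegral_mul_eq_zero_of_degree_lt (a b : ℝ) (r : ℝ[X]) (p : ℕ → ℝ[X])
    (n : ℕ) (hdeg : ∀ k < n, (p k).degree = (k : WithBot ℕ))
    (horth : ∀ k < n, ∫ t in a..b, r.eval t * (p k).eval t = 0) (q : ℝ[X])
    (hq : q.degree < (n : WithBot ℕ)) : ∫ t in a..b, r.eval t * q.eval t = 0 := by
  induction n generalizing q with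
  | zero =>
    have : q = 0 := by simpa using hq
    simp [this]
  | succ n ih =>
    have hpn : (p n).coeff n ≠ 0 := coeff_ne_zero_of_eq_degree (hdeg n n.lt_succ_self)
    set c : ℝ := q.coeff n / (p n).coeff n with hc
    have hlt : (q - C c * p n).degree < (n : WithBot ℕ) := by
      rw [degree_lt_iff_coeff_zero]
      intro m hm
      rw [coeff_sub, coeff_C_mul]
      rcases hm.eq_or_lt with rfl | hm
      · rw [hc, div_mul_cancel₀ _ hpn, sub_self]
      · rw [(degree_lt_iff_coeff_zero q (n + 1)).1 hq m hm,
          coeff_eq_zero_of_degree_lt (p := p n)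
            (by rw [hdeg n n.lt_succ_self]; exact_mod_cast hm)]
        simp
    have key := ih (fun k hk => hdeg k (hk.trans n.lt_succ_self))
      (fun k hk => horth k (hk.trans n.lt_succ_self)) _ hlt
    have hsplit : ∀ t, r.eval t * q.eval t =
        r.eval t * (q - C c * p n).eval t + c * (r.eval t * (p n).eval t) := by
      intro t
      simp only [eval_sub, eval_mul, eval_C]
      ring
    simp_rw [hsplit]
    rw [intervalIntegral.integral_add, key, intervalIntegral.integral_const_mul,
      horth n n.lt_succ_self, mul_zero, add_zero]
    · exact Continuous.intervalIntegrable (by fun_prop) _ _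
    · exact Continuous.intervalIntegrable (by fun_prop) _ _

open Polynomial

theorem exact_inverse_mass_gives_exact_diff_matrix
    (N : ℕ) (hN : 1 ≤ N)
    (x : Fin (N + 1) → ℝ) (hx : Function.Injective x)
    (w : Fin (N + 1) → ℝ) (hw : ∀ j, 0 < w j)
    (hquad : ∀ f : Polynomial ℝ, f.degree ≤ (2 * N - 1 : ℕ) →
      ∑ j, w j * f.eval (x j) = ∫ t in (-1 : ℝ)..1, f.eval t)
    (p : Fin (N + 1) → Polynomial ℝ)
    (hdeg : ∀ k : Fin (N + 1), (p k).degree = ((k : ℕ) : WithBot ℕ))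
    (horth : ∀ j k : Fin (N + 1), j ≠ k →
      (∫ t in (-1 : ℝ)..1, (p j).eval t * (p k).eval t) = 0)
    (hN' γN : ℝ)
    (hhN : hN' = ∫ t in (-1 : ℝ)..1, ((p (Fin.last N)).eval t) ^ 2)
    (hhN0 : 0 < hN')
    (hγN : γN = ∑ j, w j * ((p (Fin.last N)).eval (x j)) ^ 2)
    (β : ℝ) (hβ : β = -(hN' - γN) / (γN * hN'))
    (K S : Matrix (Fin (N + 1)) (Fin (N + 1)) ℝ)
    (hK : ∀ i j, K i j =
      (if i = j then 1 / w i else 0) +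
        β * (p (Fin.last N)).eval (x i) * (p (Fin.last N)).eval (x j))
    (hS : ∀ j k, S j k =
      ∫ t in (-1 : ℝ)..1,
        (Lagrange.basis Finset.univ x j).eval t *
          (Polynomial.derivative (Lagrange.basis Finset.univ x k)).eval t) :
    ∀ i k : Fin (N + 1),
      (∑ j, K i j * S j k) =
        (Polynomial.derivative (Lagrange.basis Finset.univ x k)).eval (x i) := by
  intro i k
  have hbasis (j : Fin (N + 1)) : (Lagrange.basis Finset.univ x j).degree = (N : WithBot ℕ) := by
    simpa using Lagrange.degree_basis hx.injOn (Finset.mem_univ j)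
  set d := derivative (Lagrange.basis Finset.univ x k) with hd
  have hdlt : d.degree < (N : WithBot ℕ) := by
    rw [← hbasis k]
    refine degree_derivative_lt fun h => ?_
    have := hbasis k
    simp [h] at this
  have hquad_mul (r : ℝ[X]) (hr : r.degree ≤ (N : WithBot ℕ)) :
      ∑ j, w j * (r.eval (x j) * d.eval (x j)) = ∫ t in (-1 : ℝ)..1, r.eval t * d.eval t := by
    have hle : d.natDegree ≤ N - 1 := by
      rcases eq_or_ne d 0 with h | h
      · simp [h]
      · have := (natDegree_lt_iff_degree_lt h).2 hdlt
        omega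
    have hmul : (r * d).degree ≤ (2 * N - 1 : ℕ) := by
      rw [← natDegree_le_iff_degree_le]
      have := natDegree_mul_le_of_le (natDegree_le_iff_degree_le.2 hr) hle
      omega
    simpa using hquad _ hmul
  have hS' (j : Fin (N + 1)) : S j k = w j * d.eval (x j) := by
    rw [hS, ← hd, ← hquad_mul _ (hbasis j).le, Finset.sum_eq_single j]
    · rw [Lagrange.eval_basis_self hx.injOn (Finset.mem_univ j), one_mul]
    · intro m _ hm
      rw [Lagrange.eval_basis_of_ne hm.symm (Finset.mem_univ m), zero_mul, mul_zero]
    · simp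
  have hortho : ∑ j, w j * ((p (Fin.last N)).eval (x j) * d.eval (x j)) = 0 := by
    rw [hquad_mul _ (by simp [hdeg])]
    refine intervalIntegral_mul_eq_zero_of_degree_lt _ _ _ (fun m => p (Fin.ofNat (N + 1) m)) N
      (fun m hm => ?_) (fun m hm => horth _ _ fun h => ?_) d hdlt
    · simp [hdeg, Nat.mod_eq_of_lt (hm.trans N.lt_succ_self)]
    · have := congrArg Fin.val h
      simp [Nat.mod_eq_of_lt (hm.trans N.lt_succ_self)] at this
      omega
  calc ∑ j, K i j * S j k
      = ∑ j, ((if i = j then d.eval (x j) else 0) + β * (p (Fin.last N)).eval (x i) *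
          (w j * ((p (Fin.last N)).eval (x j) * d.eval (x j)))) := by
        refine Finset.sum_congr rfl fun j _ => ?_
        have := (hw j).ne'
        rw [hK, hS']
        split_ifs with h
        · subst h
          field_simp
        · ring
    _ = d.eval (x i) := by
        rw [Finset.sum_add_distrib, ← Finset.mul_sum, hortho]
        simp
end
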